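/- Let q be an indecomposable pattern of length k ≥ 2, and let q'' be the pattern of length k+2 defined by q''(1) = 1, q''(i+1) = q(i) + 1 for 1 ≤ i ≤ k, and q''(k+2) = k+2. If the sequence (S_n(q))^{1/n} converges to a real number L, then the limit inferior of the sequence (S_n(q''))^{1/n} is at least (2 + √L)². -/

import Mathlib

/-- A permutation `p` of length `n` contains the pattern `q` of length `k`:
there are positions `f 0 < f 1 < … < f (k-1)` whose values are order-isomorphic to `q`. -/
def PermContains {n k : ℕ} (p : Equiv.Perm (Fin n)) (q : Equiv.Perm (Fin k)) : Prop :=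
  ∃ f : Fin k → Fin n, StrictMono f ∧ ∀ a b : Fin k, p (f a) < p (f b) ↔ q a < q b

/-- `p` avoids the pattern `q`. -/
def PermAvoids {n k : ℕ} (p : Equiv.Perm (Fin n)) (q : Equiv.Perm (Fin k)) : Prop :=
  ¬ PermContains p q

/-- `avoiders n q` is `S_n(q)`, the number of permutations of length `n` avoiding `q`. -/
noncomputable def avoiders (n : ℕ) {k : ℕ} (q : Equiv.Perm (Fin k)) : ℕ :=
  Nat.card {p : Equiv.Perm (Fin n) // PermAvoids p q}

/-- The pattern 12453 (0-indexed: 0,1,3,4,2). -/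
def pat12453 : Equiv.Perm (Fin 5) :=
  ⟨![0, 1, 3, 4, 2], ![0, 1, 4, 2, 3], by decide, by decide⟩

/-- `p i` is a left-to-right minimum of `p`: every earlier entry is larger. -/
def IsLtrMin {n : ℕ} (p : Equiv.Perm (Fin n)) (i : Fin n) : Prop :=
  ∀ j : Fin n, j < i → p i < p j

/-- The sequence `s` contains the pattern `q` using only positions satisfying `P`:
there is a subsequence, supported on positions satisfying `P`, order-isomorphic to `q`.
Taking `P := fun _ => True` gives ordinary pattern containment in the sequence `s`;
taking `P i := ¬ IsLtrMin p i` and `s := p` gives pattern containment in the string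
of remaining entries of a permutation `p`. -/
def ContainsOn {α : Type*} [LinearOrder α] {m k : ℕ} (s : Fin m → α)
    (P : Fin m → Prop) (q : Equiv.Perm (Fin k)) : Prop :=
  ∃ f : Fin k → Fin m, StrictMono f ∧ (∀ a : Fin k, P (f a)) ∧
    ∀ a b : Fin k, s (f a) < s (f b) ↔ q a < q b

/-- A pattern `q` of length `k` is indecomposable if it cannot be cut into two parts
so that all entries before the cut are larger than all entries after the cut:
there is no `r` with `1 ≤ r < k` such that the first `r` positions carry exactly
the top `r` values `{k-r, …, k-1}` (0-indexed). -/
def Indecomposable {k : ℕ} (q : Equiv.Perm (Fin k)) : Prop :=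
  ¬ ∃ r : ℕ, 1 ≤ r ∧ r < k ∧ ∀ i : Fin k, ((i : ℕ) < r ↔ k - r ≤ (q i : ℕ))

/-- A pattern `q` is layered: positions can be labelled by a monotone block function `b`
(whose fibers are then consecutive intervals, the layers) such that `q` is decreasing
within each layer and entries in earlier layers are smaller than those in later layers,
i.e. for `i < j`, `q j < q i` exactly when `i` and `j` are in the same layer. -/
def Layered {k : ℕ} (q : Equiv.Perm (Fin k)) : Prop :=
  ∃ b : Fin k → ℕ, Monotone b ∧ ∀ i j : Fin k, i < j → (q j < q i ↔ b i = b j)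


/-! ### The Marcus–Tardos theorem for point sets -/

/-- A finite set of lattice points (the ones of a 0-1 matrix) contains the permutation
matrix of `q`. -/
def PointsContain {k : ℕ} (A : Finset (ℕ × ℕ)) (q : Equiv.Perm (Fin k)) : Prop :=
  ∃ f g : Fin k → ℕ, StrictMono f ∧ StrictMono g ∧ ∀ a, (f a, g (q a)) ∈ A

/-- The `n × n` grid. -/
def grid (n : ℕ) : Finset (ℕ × ℕ) := Finset.range n ×ˢ Finset.range n

/-- The `b × b` block containing a lattice point. -/
def blockOf (b : ℕ) (c : ℕ × ℕ) : ℕ × ℕ := (c.1 / b, c.2 / b)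

/-- The set of nonempty `b × b` blocks of a point set. -/
def contract (b : ℕ) (A : Finset (ℕ × ℕ)) : Finset (ℕ × ℕ) := A.image (blockOf b)

/-- The points of `A` in the block `c`. -/
def blockPart (b : ℕ) (A : Finset (ℕ × ℕ)) (c : ℕ × ℕ) : Finset (ℕ × ℕ) :=
  A.filter (fun x => blockOf b x = c)

/-- The second coordinates, relative to the block, of the points of `A` in the block `c`. -/
def blockCols (b : ℕ) (A : Finset (ℕ × ℕ)) (c : ℕ × ℕ) : Finset ℕ :=
  (blockPart b A c).image (fun x => x.2 % b)

/-- The first coordinates, relative to the block, of the points of `A` in the block `c`. -/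
def blockRows (b : ℕ) (A : Finset (ℕ × ℕ)) (c : ℕ × ℕ) : Finset ℕ :=
  (blockPart b A c).image (fun x => x.1 % b)

lemma PointsContain.of_contract {k : ℕ} {q : Equiv.Perm (Fin k)} {b : ℕ}
    {A : Finset (ℕ × ℕ)} (h : PointsContain (contract b A) q) : PointsContain A q := by
  obtain ⟨f, g, hf, hg, hA⟩ := h
  have hx : ∀ a, ∃ x ∈ A, blockOf b x = (f a, g (q a)) := fun a => by
    simpa [contract] using hA a
  choose x hxA hxb using hx
  have h1 : ∀ a, (x a).1 / b = f a := fun a => congrArg Prod.fst (hxb a)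
  have h2 : ∀ a, (x a).2 / b = g (q a) := fun a => congrArg Prod.snd (hxb a)
  refine ⟨fun a => (x a).1, fun a => (x (q.symm a)).2, ?_, ?_, ?_⟩
  · intro a a' haa
    by_contra! hle
    have := Nat.div_le_div_right (c := b) hle
    rw [h1, h1] at this
    exact absurd (hf haa) (not_lt.2 this)
  · intro a a' haa
    by_contra! hle
    have := Nat.div_le_div_right (c := b) hle
    rw [h2, h2, Equiv.apply_symm_apply, Equiv.apply_symm_apply] at this
    exact absurd (hg haa) (not_lt.2 this)
  · intro a
    simpa using hxA a

lemma contract_subset_grid {b n : ℕ} {A : Finset (ℕ × ℕ)}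
    (h : A ⊆ grid (b * n)) : contract b A ⊆ grid n := by
  intro c hc
  obtain ⟨x, hx, rfl⟩ := Finset.mem_image.1 hc
  have := h hx
  simp only [grid, Finset.mem_product, Finset.mem_range, blockOf] at this ⊢
  exact ⟨Nat.div_lt_of_lt_mul this.1, Nat.div_lt_of_lt_mul this.2⟩

lemma PointsContain.of_swap {k : ℕ} {q : Equiv.Perm (Fin k)} {A : Finset (ℕ × ℕ)}
    (h : PointsContain (A.image Prod.swap) q⁻¹) : PointsContain A q := by
  obtain ⟨f, g, hf, hg, hA⟩ := h
  refine ⟨g, f, hg, hf, fun a => ?_⟩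
  have := hA (q a)
  simpa using this

/-- Few blocks of a pattern-avoiding point set meet at least `k` columns. -/
lemma card_wide_le {k : ℕ} {q : Equiv.Perm (Fin k)} {b n : ℕ} (hb : 0 < b)
    {A : Finset (ℕ × ℕ)} (h : A ⊆ grid (b * n)) (hA : ¬ PointsContain A q) :
    ((contract b A).filter (fun c => k ≤ (blockCols b A c).card)).card ≤ n * 2 ^ b * k := by
  by_contra! hlt
  have hmaps : ∀ c ∈ (contract b A).filter (fun c => k ≤ (blockCols b A c).card),
      (c.2, blockCols b A c) ∈ Finset.range n ×ˢ (Finset.range b).powerset := by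
    intro c hc
    have hc' := contract_subset_grid h (Finset.mem_filter.1 hc).1
    simp only [grid, Finset.mem_product, Finset.mem_range] at hc'
    refine Finset.mem_product.2 ⟨Finset.mem_range.2 hc'.2, Finset.mem_powerset.2 ?_⟩
    intro y hy
    obtain ⟨x, -, rfl⟩ := Finset.mem_image.1 hy
    exact Finset.mem_range.2 (Nat.mod_lt _ hb)
  obtain ⟨⟨j, U⟩, -, hcard⟩ := Finset.exists_lt_card_fiber_of_mul_lt_card_of_maps_to
    (n := k) hmaps (by simpa using hlt)
  set W := ((contract b A).filter (fun c => k ≤ (blockCols b A c).card)).filter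
    (fun c => (c.2, blockCols b A c) = (j, U)) with hW
  have hWmem : ∀ c ∈ W, c.2 = j ∧ blockCols b A c = U ∧ k ≤ U.card := by
    intro c hc
    simp only [hW, Finset.mem_filter, Prod.mk.injEq] at hc
    exact ⟨hc.2.1, hc.2.2, hc.2.2 ▸ hc.1.2⟩
  have hWfst : (W.image Prod.fst).card = W.card := by
    refine Finset.card_image_of_injOn fun c hc c' hc' hcc => ?_
    exact Prod.ext hcc ((hWmem c hc).1.trans (hWmem c' hc').1.symm)
  obtain ⟨R, hR, hRk⟩ := Finset.exists_subset_card_eq (s := W.image Prod.fst) (n := k)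
    (by rw [hWfst]; exact hcard.le)
  obtain ⟨c₀, hc₀⟩ : W.Nonempty := Finset.card_pos.1 (by omega)
  obtain ⟨V, hV, hVk⟩ := Finset.exists_subset_card_eq (hWmem c₀ hc₀).2.2
  have hpt : ∀ a a' : Fin k, ∃ x, (x, j * b + V.orderEmbOfFin hVk a') ∈ A ∧
      x / b = R.orderEmbOfFin hRk a := by
    intro a a'
    obtain ⟨c, hc, hca⟩ := Finset.mem_image.1 (hR (R.orderEmbOfFin_mem hRk a))
    obtain ⟨hcj, hcU, -⟩ := hWmem c hc
    have hu := hV (V.orderEmbOfFin_mem hVk a')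
    rw [← hcU] at hu
    obtain ⟨x, hx, hxu⟩ := Finset.mem_image.1 hu
    obtain ⟨hxA, hxc⟩ := Finset.mem_filter.1 hx
    have e1 : x.1 / b = c.1 := congrArg Prod.fst hxc
    have e2 : x.2 / b = c.2 := congrArg Prod.snd hxc
    refine ⟨x.1, ?_, e1.trans hca⟩
    have : j * b + V.orderEmbOfFin hVk a' = x.2 := by
      rw [← hxu, ← hcj, ← e2, mul_comm]
      exact Nat.div_add_mod _ _
    rw [this]
    exact hxA
  choose x hxA hxb using hpt
  refine hA ⟨fun a => x a (q a), fun a => j * b + V.orderEmbOfFin hVk a, ?_, ?_, fun a => hxA _ _⟩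
  · intro a a' haa
    by_contra! hle
    have := Nat.div_le_div_right (c := b) hle
    rw [hxb, hxb] at this
    exact absurd ((R.orderEmbOfFin hRk).strictMono haa) (not_lt.2 this)
  · intro a a' haa
    exact Nat.add_lt_add_left ((V.orderEmbOfFin hVk).strictMono haa) _

lemma swap_subset_grid {n : ℕ} {A : Finset (ℕ × ℕ)} (h : A ⊆ grid n) :
    A.image Prod.swap ⊆ grid n := by
  intro c hc
  obtain ⟨x, hx, rfl⟩ := Finset.mem_image.1 hc
  have := h hx
  simp only [grid, Finset.mem_product, Finset.mem_range, Prod.swap] at this ⊢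
  exact this.symm

lemma blockCols_swap (b : ℕ) (A : Finset (ℕ × ℕ)) (c : ℕ × ℕ) :
    blockCols b (A.image Prod.swap) c.swap = blockRows b A c := by
  ext y
  simp only [blockCols, blockRows, blockPart, blockOf, Finset.mem_image, Finset.mem_filter,
    Prod.exists, Prod.swap, Prod.ext_iff]
  grind

lemma card_tall_le {k : ℕ} {q : Equiv.Perm (Fin k)} {b n : ℕ} (hb : 0 < b)
    {A : Finset (ℕ × ℕ)} (h : A ⊆ grid (b * n)) (hA : ¬ PointsContain A q) :
    ((contract b A).filter (fun c => k ≤ (blockRows b A c).card)).card ≤ n * 2 ^ b * k := by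
  refine le_trans ?_ (card_wide_le hb (swap_subset_grid h) (fun hc => hA hc.of_swap))
  refine Finset.card_le_card_of_injOn Prod.swap ?_ Prod.swap_injective.injOn
  intro c hc
  obtain ⟨hc1, hc2⟩ := Finset.mem_filter.1 hc
  refine Finset.mem_filter.2 ⟨?_, by rwa [blockCols_swap]⟩
  obtain ⟨x, hx, rfl⟩ := Finset.mem_image.1 hc1
  exact Finset.mem_image.2 ⟨x.swap, Finset.mem_image_of_mem _ hx, rfl⟩

lemma blockPart_card_le (b : ℕ) (A : Finset (ℕ × ℕ)) (c : ℕ × ℕ) :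
    (blockPart b A c).card ≤ (blockRows b A c).card * (blockCols b A c).card := by
  rw [← Finset.card_product]
  refine Finset.card_le_card_of_injOn (fun x => (x.1 % b, x.2 % b)) ?_ ?_
  · intro x hx
    exact Finset.mem_product.2 ⟨Finset.mem_image_of_mem _ hx, Finset.mem_image_of_mem _ hx⟩
  · intro x hx y hy hxy
    have hx' : blockOf b x = c := (Finset.mem_filter.1 hx).2
    have hy' : blockOf b y = c := (Finset.mem_filter.1 hy).2
    have hxy' := hx'.trans hy'.symm
    simp only [blockOf, Prod.mk.injEq] at hxy hxy'
    ext
    · rw [← Nat.div_add_mod x.1 b, hxy.1, hxy'.1, Nat.div_add_mod]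
    · rw [← Nat.div_add_mod x.2 b, hxy.2, hxy'.2, Nat.div_add_mod]

lemma blockCols_card_le {b : ℕ} (hb : 0 < b) (A : Finset (ℕ × ℕ)) (c : ℕ × ℕ) :
    (blockCols b A c).card ≤ b := by
  refine (Finset.card_le_card (t := Finset.range b) fun y hy => ?_).trans_eq (by simp)
  obtain ⟨x, -, rfl⟩ := Finset.mem_image.1 hy
  exact Finset.mem_range.2 (Nat.mod_lt _ hb)

lemma blockRows_card_le {b : ℕ} (hb : 0 < b) (A : Finset (ℕ × ℕ)) (c : ℕ × ℕ) :
    (blockRows b A c).card ≤ b := by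
  refine (Finset.card_le_card (t := Finset.range b) fun y hy => ?_).trans_eq (by simp)
  obtain ⟨x, -, rfl⟩ := Finset.mem_image.1 hy
  exact Finset.mem_range.2 (Nat.mod_lt _ hb)

/-- The Marcus–Tardos recursion. -/
lemma card_le_contract {k : ℕ} {q : Equiv.Perm (Fin k)} {b n : ℕ} (hb : 0 < b)
    {A : Finset (ℕ × ℕ)} (h : A ⊆ grid (b * n)) (hA : ¬ PointsContain A q) :
    A.card ≤ (contract b A).card * k ^ 2 + 2 * (n * 2 ^ b * k) * b ^ 2 := by
  have hsum : A.card = ∑ c ∈ contract b A, (blockPart b A c).card :=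
    Finset.card_eq_sum_card_fiberwise fun x hx => Finset.mem_image_of_mem _ hx
  have hpt : ∀ c ∈ contract b A, (blockPart b A c).card ≤
      k ^ 2 + ((if k ≤ (blockCols b A c).card then b ^ 2 else 0) +
        (if k ≤ (blockRows b A c).card then b ^ 2 else 0)) := by
    intro c _
    have h0 := blockPart_card_le b A c
    have h1 := Nat.mul_le_mul (blockRows_card_le hb A c) (blockCols_card_le hb A c)
    rw [← pow_two] at h1
    split_ifs with h2 h3 h3
    · omega
    · omega
    · omega
    · have := Nat.mul_le_mul (not_le.1 h3).le (not_le.1 h2).le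
      rw [← pow_two] at this
      omega
  rw [hsum]
  refine (Finset.sum_le_sum hpt).trans ?_
  rw [Finset.sum_add_distrib, Finset.sum_add_distrib, ← Finset.sum_filter, ← Finset.sum_filter]
  simp only [Finset.sum_const, smul_eq_mul]
  have h1 := Nat.mul_le_mul_right (b ^ 2) (card_wide_le hb h hA)
  have h2 := Nat.mul_le_mul_right (b ^ 2) (card_tall_le hb h hA)
  linarith

/-- The Marcus–Tardos theorem for grids whose side is a power of two. -/
theorem exists_card_le_of_not_pointsContain {k : ℕ} (q : Equiv.Perm (Fin k)) :
    ∃ C : ℕ, ∀ (m : ℕ) (A : Finset (ℕ × ℕ)), A ⊆ grid (2 ^ m) → ¬ PointsContain A q →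
      A.card ≤ C * 2 ^ m := by
  obtain ⟨j, hj⟩ : ∃ j, 2 * k ^ 2 < 2 ^ j := ⟨_, Nat.lt_two_pow_self⟩
  set b := 2 ^ j with hbdef
  have hb : 0 < b := by positivity
  refine ⟨b + 4 * (2 ^ b * k) * b ^ 2, fun m => ?_⟩
  induction m using Nat.strong_induction_on with
  | _ m ih =>
    intro A hAg hA
    rcases Nat.lt_or_ge m j with hm | hm
    · have h1 : A.card ≤ 2 ^ m * 2 ^ m := by
        simpa [grid] using Finset.card_le_card hAg
      refine h1.trans (Nat.mul_le_mul_right _ ?_)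
      exact (Nat.pow_le_pow_right (by norm_num) hm.le).trans (Nat.le_add_right _ _)
    · obtain ⟨i, rfl⟩ := Nat.exists_eq_add_of_le hm
      rcases Nat.eq_zero_or_pos j with hj0 | hj0
      · have hk : k = 0 := by
          subst hj0
          simp only [hbdef, pow_zero] at hj
          have : k ^ 2 = 0 := by omega
          simpa using this
        subst hk
        exact absurd ⟨Fin.elim0, Fin.elim0, fun a => a.elim0, fun a => a.elim0,
          fun a => a.elim0⟩ hA
      rw [pow_add] at hAg
      have h1 := card_le_contract hb hAg hA
      have h2 := ih i (by omega) (contract b A) (contract_subset_grid hAg)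
        (fun hc => hA hc.of_contract)
      set D := 2 ^ b * k * b ^ 2 with hD
      have e1 : b + 4 * (2 ^ b * k) * b ^ 2 = b + 4 * D := by rw [hD]; ring
      have e2 : 2 * (2 ^ i * 2 ^ b * k) * b ^ 2 = 2 * D * 2 ^ i := by rw [hD]; ring
      rw [e1] at h2 ⊢
      rw [e2] at h1
      have h3 := Nat.mul_le_mul_right (k ^ 2) h2
      have hb1 : 1 ≤ b := hb
      rw [pow_add, ← hbdef]
      have h4 : (b + 4 * D) * 2 ^ i * (2 * k ^ 2) ≤ (b + 4 * D) * 2 ^ i * b :=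
        Nat.mul_le_mul_left _ hj.le
      have h5 : D * 2 ^ i * 1 ≤ D * 2 ^ i * b := Nat.mul_le_mul_left _ hb1
      nlinarith [Nat.zero_le (b * 2 ^ i * b), Nat.zero_le (D * 2 ^ i * b)]

/-! ### Exponential upper bound (Klazar's reduction) -/

open Classical in
/-- The point sets in the `n × n` grid avoiding `q`. -/
noncomputable def avoidingSets (n : ℕ) {k : ℕ} (q : Equiv.Perm (Fin k)) :
    Finset (Finset (ℕ × ℕ)) :=
  (grid n).powerset.filter (fun A => ¬ PointsContain A q)

lemma mem_avoidingSets {n k : ℕ} {q : Equiv.Perm (Fin k)} {A : Finset (ℕ × ℕ)} :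
    A ∈ avoidingSets n q ↔ A ⊆ grid n ∧ ¬ PointsContain A q := by
  simp [avoidingSets]

/-- Replace every point by a `2 × 2` block. -/
def blowUp (C : Finset (ℕ × ℕ)) : Finset (ℕ × ℕ) :=
  (C ×ˢ (Finset.range 2 ×ˢ Finset.range 2)).image
    (fun x => (2 * x.1.1 + x.2.1, 2 * x.1.2 + x.2.2))

lemma card_blowUp_le (C : Finset (ℕ × ℕ)) : (blowUp C).card ≤ 4 * C.card := by
  refine Finset.card_image_le.trans ?_
  simp [mul_comm]

lemma subset_blowUp_contract (A : Finset (ℕ × ℕ)) : A ⊆ blowUp (contract 2 A) := by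
  intro x hx
  refine Finset.mem_image.2 ⟨(blockOf 2 x, (x.1 % 2, x.2 % 2)), ?_, ?_⟩
  · simp only [Finset.mem_product, Finset.mem_range]
    exact ⟨Finset.mem_image_of_mem _ hx, Nat.mod_lt _ (by norm_num), Nat.mod_lt _ (by norm_num)⟩
  · simp only [blockOf]
    ext <;> exact Nat.div_add_mod _ _

lemma exists_card_avoidingSets_le {k : ℕ} (q : Equiv.Perm (Fin k)) :
    ∃ C : ℕ, ∀ m : ℕ, (avoidingSets (2 ^ m) q).card ≤ 2 * 2 ^ (C * 2 ^ m) := by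
  obtain ⟨C, hC⟩ := exists_card_le_of_not_pointsContain q
  refine ⟨4 * C, fun m => ?_⟩
  induction m with
  | zero =>
    have h1 : (avoidingSets (2 ^ 0) q).card ≤ 2 := by
      refine (Finset.card_le_card (t := (grid (2 ^ 0)).powerset) fun A hA =>
        Finset.mem_powerset.2 (mem_avoidingSets.1 hA).1).trans ?_
      simp [grid]
    refine h1.trans ?_
    exact Nat.le_mul_of_pos_right _ (by positivity)
  | succ m ih =>
    have hsub : avoidingSets (2 ^ (m + 1)) q ⊆
        (avoidingSets (2 ^ m) q).biUnion (fun D => (blowUp D).powerset) := by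
      intro A hA
      obtain ⟨hA1, hA2⟩ := mem_avoidingSets.1 hA
      rw [pow_succ'] at hA1
      exact Finset.mem_biUnion.2 ⟨contract 2 A, mem_avoidingSets.2
        ⟨contract_subset_grid hA1, fun h => hA2 h.of_contract⟩,
        Finset.mem_powerset.2 (subset_blowUp_contract A)⟩
    refine (Finset.card_le_card hsub).trans (Finset.card_biUnion_le.trans ?_)
    have hb : ∀ D ∈ avoidingSets (2 ^ m) q,
        (blowUp D).powerset.card ≤ 2 ^ (4 * C * 2 ^ m) := by
      intro D hD
      obtain ⟨hD1, hD2⟩ := mem_avoidingSets.1 hD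
      rw [Finset.card_powerset]
      refine Nat.pow_le_pow_right (by norm_num) ((card_blowUp_le D).trans ?_)
      rw [mul_assoc]
      exact Nat.mul_le_mul_left _ (hC m D hD1 hD2)
    refine (Finset.sum_le_card_nsmul _ _ _ hb).trans ?_
    rw [smul_eq_mul]
    refine (Nat.mul_le_mul_right _ ih).trans_eq ?_
    rw [mul_assoc, ← pow_add, pow_succ]
    congr 2
    ring

/-- The points of the graph of a permutation. -/
def permGraph {n : ℕ} (p : Equiv.Perm (Fin n)) : Finset (ℕ × ℕ) :=
  Finset.univ.image (fun i : Fin n => ((i : ℕ), (p i : ℕ)))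

lemma PermContains.of_permGraph {n k : ℕ} {p : Equiv.Perm (Fin n)} {q : Equiv.Perm (Fin k)}
    (h : PointsContain (permGraph p) q) : PermContains p q := by
  obtain ⟨f, g, hf, hg, hA⟩ := h
  have hx : ∀ a, ∃ i : Fin n, (i : ℕ) = f a ∧ (p i : ℕ) = g (q a) := fun a => by
    simpa [permGraph] using hA a
  choose x hx1 hx2 using hx
  refine ⟨x, fun a a' haa => ?_, fun a a' => ?_⟩
  · rw [Fin.lt_def, hx1, hx1]
    exact hf haa
  · rw [Fin.lt_def, hx2, hx2]
    exact hg.lt_iff_lt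

lemma permGraph_injective {n : ℕ} :
    Function.Injective (permGraph : Equiv.Perm (Fin n) → Finset (ℕ × ℕ)) := by
  intro p p' h
  ext i
  have : ((i : ℕ), (p i : ℕ)) ∈ permGraph p' := h ▸ Finset.mem_image_of_mem _ (Finset.mem_univ i)
  obtain ⟨i', -, hi'⟩ := Finset.mem_image.1 this
  obtain ⟨h1, h2⟩ := Prod.mk.inj hi'
  rw [Fin.ext h1] at h2
  exact h2.symm

lemma avoiders_le_card_avoidingSets {k : ℕ} (n : ℕ) (q : Equiv.Perm (Fin k)) :
    avoiders n q ≤ (avoidingSets n q).card := by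
  have : (avoidingSets n q).card = Nat.card (avoidingSets n q) := by simp
  rw [this]
  refine Nat.card_le_card_of_injective
    (fun p => ⟨permGraph p.1, mem_avoidingSets.2 ⟨?_, fun h => p.2 (.of_permGraph h)⟩⟩) ?_
  · intro c hc
    obtain ⟨i, -, rfl⟩ := Finset.mem_image.1 hc
    simp [grid]
  · intro p p' h
    exact Subtype.ext (permGraph_injective (congrArg Subtype.val h))

/-- Avoidance classes grow at most exponentially along powers of two. -/
lemma exists_avoiders_two_pow_le {k : ℕ} (q : Equiv.Perm (Fin k)) :
    ∃ B : ℕ, ∀ m : ℕ, avoiders (2 ^ m) q ≤ B ^ 2 ^ m := by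
  obtain ⟨C, hC⟩ := exists_card_avoidingSets_le q
  refine ⟨2 * 2 ^ C, fun m => ((avoiders_le_card_avoidingSets _ q).trans (hC m)).trans ?_⟩
  rw [mul_pow, ← pow_mul]
  exact Nat.mul_le_mul_right _ (Nat.le_self_pow (by positivity) 2)

/-! ### Symmetry, monotonicity and indecomposability -/

/-- The reverse-complement of a permutation. -/
def revCompl {n : ℕ} (p : Equiv.Perm (Fin n)) : Equiv.Perm (Fin n) :=
  Fin.revPerm.trans (p.trans Fin.revPerm)

@[simp] lemma revCompl_apply {n : ℕ} (p : Equiv.Perm (Fin n)) (i : Fin n) :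
    revCompl p i = (p i.rev).rev := rfl

@[simp] lemma revCompl_revCompl {n : ℕ} (p : Equiv.Perm (Fin n)) :
    revCompl (revCompl p) = p := by
  ext i
  simp

lemma PermContains.revCompl {n k : ℕ} {p : Equiv.Perm (Fin n)} {q : Equiv.Perm (Fin k)}
    (h : PermContains p q) : PermContains (revCompl p) (revCompl q) := by
  obtain ⟨f, hf, hfq⟩ := h
  refine ⟨fun a => (f a.rev).rev, fun a b hab => ?_, fun a b => ?_⟩
  · exact Fin.rev_lt_rev.2 (hf (Fin.rev_lt_rev.2 hab))
  · simp [Fin.rev_lt_rev, hfq]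

lemma avoiders_revCompl_le {k : ℕ} (n : ℕ) (q : Equiv.Perm (Fin k)) :
    avoiders n q ≤ avoiders n (revCompl q) := by
  refine Nat.card_le_card_of_injective (fun p => ⟨revCompl p.1, fun h => p.2 ?_⟩) ?_
  · simpa using h.revCompl
  · intro p p' h
    have := congrArg (fun r => revCompl r.1) h
    exact Subtype.ext (by simpa using this)

lemma Indecomposable.revCompl {k : ℕ} {q : Equiv.Perm (Fin k)} (hq : Indecomposable q) :
    Indecomposable (revCompl q) := by
  rintro ⟨r, hr1, hrk, h⟩
  refine hq ⟨k - r, by omega, by omega, fun i => ?_⟩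
  have := h i.rev
  simp only [revCompl_apply, Fin.rev_rev, Fin.val_rev] at this
  omega

/-- In an indecomposable pattern, a monotone labelling of the positions for which larger
labels carry smaller values is constant. -/
lemma Indecomposable.label_eq {k : ℕ} {q : Equiv.Perm (Fin k)} (hq : Indecomposable q)
    {b : Fin k → ℕ} (hb : Monotone b) (h : ∀ a a', b a < b a' → q a' < q a) (a a' : Fin k) :
    b a = b a' := by
  wlog haa : a ≤ a' generalizing a a'
  · exact (this a' a (le_of_not_ge haa)).symm
  by_contra hne
  have hlt : b a < b a' := lt_of_le_of_ne (hb haa) hne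
  have hne : (Finset.univ.filter fun i => b a < b i).Nonempty := ⟨a', by simpa using hlt⟩
  set r := (Finset.univ.filter fun i => b a < b i).min' hne with hr
  have hrmem : b a < b r := by
    simpa using Finset.min'_mem _ hne
  have hiff : ∀ i, i < r ↔ b i ≤ b a := by
    intro i
    constructor
    · intro hi
      by_contra! hlt
      exact absurd (Finset.min'_le _ i (by simpa using hlt)) (not_le.2 hi)
    · intro hi
      by_contra! hle
      exact absurd (hb hle) (by omega)
  have hra : a < r := (hiff a).2 le_rfl
  refine hq ⟨r, by have := Fin.lt_def.1 hra; omega, r.isLt, fun i => ?_⟩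
  rw [← Fin.lt_def]
  constructor
  · intro hi
    have hsub : (Finset.Ici r).map q.toEmbedding ⊆ Finset.Iio (q i) := by
      intro y hy
      obtain ⟨j, hj, rfl⟩ := Finset.mem_map.1 hy
      refine Finset.mem_Iio.2 (h _ _ ?_)
      have h1 := (hiff i).1 hi
      have h2 := hb (Finset.mem_Ici.1 hj)
      omega
    simpa using Finset.card_le_card hsub
  · intro hi
    by_contra hir
    have hsub : (Finset.Iio r).map q.toEmbedding ⊆ Finset.Ioi (q i) := by
      intro y hy
      obtain ⟨j, hj, rfl⟩ := Finset.mem_map.1 hy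
      refine Finset.mem_Ioi.2 (h _ _ ?_)
      have h1 := (hiff j).1 (Finset.mem_Iio.1 hj)
      have h2 := mt (hiff i).2 hir
      omega
    have := Finset.card_le_card hsub
    simp only [Finset.card_map, Fin.card_Iio, Fin.card_Ioi] at this
    have := (q i).isLt
    have := r.isLt
    omega

/-- Prepend a new maximum to a permutation. -/
def consMax {n : ℕ} (p : Equiv.Perm (Fin n)) : Equiv.Perm (Fin (n + 1)) :=
  (finSuccEquiv n).trans ((Equiv.optionCongr p).trans finSuccEquivLast.symm)

@[simp] lemma consMax_zero {n : ℕ} (p : Equiv.Perm (Fin n)) : consMax p 0 = Fin.last n := by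
  simp [consMax]

@[simp] lemma consMax_succ {n : ℕ} (p : Equiv.Perm (Fin n)) (i : Fin n) :
    consMax p i.succ = (p i).castSucc := by
  simp [consMax]

lemma PermAvoids.consMax {n k : ℕ} (hk : 2 ≤ k) {q : Equiv.Perm (Fin k)}
    (hq : Indecomposable q) {p : Equiv.Perm (Fin n)} (h : PermAvoids p q) :
    PermAvoids (consMax p) q := by
  rintro ⟨f, hf, hfq⟩
  have key : ∀ a, f a ≠ 0 := by
    intro a ha
    have ha0 : ∀ a', a ≤ a' := fun a' => by
      by_contra! hlt
      have := hf hlt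
      rw [ha] at this
      exact absurd this (Fin.not_lt_zero _)
    have hmax : ∀ a', a' ≠ a → q a' < q a := by
      intro a' ha'
      rw [← hfq, ha, consMax_zero]
      have hne : f a' ≠ 0 := fun h0 => ha' (hf.injective (h0.trans ha.symm))
      obtain ⟨j, hj⟩ := Fin.exists_succ_eq.2 hne
      rw [← hj, consMax_succ]
      exact Fin.castSucc_lt_last _
    have hlab := hq.label_eq (b := fun i => if i = a then 0 else 1) (fun i j hij => by
      by_cases hi : i = a
      · simp [hi]
      · have : j ≠ a := fun hj => hi (le_antisymm (hj ▸ hij) (ha0 i))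
        simp [hi, this]) (fun i j hij => by
      by_cases hi : i = a
      · subst hi
        by_cases hj : j = i
        · simp [hj] at hij
        · exact hmax _ hj
      · by_cases hj : j = a <;> simp [hi, hj] at hij)
    have : Nontrivial (Fin k) := Fin.nontrivial_iff_two_le.2 hk
    obtain ⟨c, hc⟩ := exists_ne a
    have := hlab c a
    simp [hc] at this
  choose g hg using fun a => Fin.exists_succ_eq.2 (key a)
  refine h ⟨g, fun a b hab => ?_, fun a b => ?_⟩
  · rw [← Fin.succ_lt_succ_iff, hg, hg]
    exact hf hab
  · rw [← hfq, ← hg, ← hg, consMax_succ, consMax_succ, Fin.castSucc_lt_castSucc_iff]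

lemma avoiders_mono {k : ℕ} (hk : 2 ≤ k) {q : Equiv.Perm (Fin k)} (hq : Indecomposable q) :
    Monotone fun n => avoiders n q := by
  refine monotone_nat_of_le_succ fun n => ?_
  refine Nat.card_le_card_of_injective (fun p => ⟨consMax p.1, p.2.consMax hk hq⟩) ?_
  intro p p' h
  refine Subtype.ext (Equiv.ext fun i => ?_)
  have := congrArg (fun r => r.1 i.succ) h
  simpa using this

lemma one_le_avoiders {k : ℕ} (hk : 2 ≤ k) {q : Equiv.Perm (Fin k)} (hq : Indecomposable q)
    (n : ℕ) : 1 ≤ avoiders n q := by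
  refine le_trans ?_ (avoiders_mono hk hq (Nat.zero_le n))
  have : Nonempty {p : Equiv.Perm (Fin 0) // PermAvoids p q} :=
    ⟨⟨1, fun ⟨f, _, _⟩ => (f ⟨0, by omega⟩).elim0⟩⟩
  exact Nat.card_pos

/-- `q'` is obtained from `q` by adding one to each entry and prepending a new minimum. -/
def IsPrepend {k : ℕ} (q' : Equiv.Perm (Fin (k + 1))) (q : Equiv.Perm (Fin k)) : Prop :=
  q' 0 = 0 ∧ ∀ i : Fin k, q' i.succ = (q i).succ

lemma exists_isPrepend {k : ℕ} (q : Equiv.Perm (Fin k)) : ∃ q', IsPrepend q' q :=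
  ⟨Equiv.Perm.decomposeFin.symm (0, q), by simp, fun i => by simp⟩

lemma IsPrepend.indecomposable {k : ℕ} {q' : Equiv.Perm (Fin (k + 1))} {q : Equiv.Perm (Fin k)}
    (h : IsPrepend q' q) : Indecomposable q' := by
  rintro ⟨r, hr1, hrk, hr⟩
  have := hr 0
  rw [h.1] at this
  simp only [Fin.val_zero] at this
  omega

/-! ### Interleaving skew sums with decreasing sequences -/

/-- The ways of interleaving `N` points with `d` points. -/
abbrev Shuffle (N d : ℕ) := {S : Finset (Fin (N + d)) // S.card = N}

/-- The interleaving as an equivalence, increasing on both parts. -/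
def shuffleEquiv {N d : ℕ} (S : Shuffle N d) : Fin N ⊕ Fin d ≃ Fin (N + d) :=
  finSumEquivOfFinset S.2 (n := d) (by rw [Finset.card_compl, S.2, Fintype.card_fin]; omega)

lemma shuffleEquiv_inl_lt {N d : ℕ} (S : Shuffle N d) {x x' : Fin N} :
    shuffleEquiv S (.inl x) < shuffleEquiv S (.inl x') ↔ x < x' := by
  simp [shuffleEquiv]

lemma shuffleEquiv_inr_lt {N d : ℕ} (S : Shuffle N d) {y y' : Fin d} :
    shuffleEquiv S (.inr y) < shuffleEquiv S (.inr y') ↔ y < y' := by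
  simp [shuffleEquiv]

lemma shuffleEquiv_inl_mem {N d : ℕ} (S : Shuffle N d) (x : Fin N) :
    shuffleEquiv S (.inl x) ∈ S.1 := by
  simp [shuffleEquiv]

lemma shuffleEquiv_inr_notMem {N d : ℕ} (S : Shuffle N d) (y : Fin d) :
    shuffleEquiv S (.inr y) ∉ S.1 := by
  rw [shuffleEquiv, finSumEquivOfFinset_inr, ← Finset.mem_compl]
  exact Finset.orderEmbOfFin_mem _ _ _

lemma natCard_shuffle (N d : ℕ) : Nat.card (Shuffle N d) = (N + d).choose N := by
  rw [Nat.card_eq_fintype_card, Fintype.card_finset_len, Fintype.card_fin]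

/-- The interleaving used in the value block `i`; the two extreme blocks are trivial. -/
def valueShuffle {N d t : ℕ} (B : Fin t → Shuffle N d) (i : ℕ) :
    Fin N ⊕ Fin d ≃ Fin (N + d) :=
  if h : 1 ≤ i ∧ i ≤ t then shuffleEquiv (B ⟨i - 1, by omega⟩) else finSumFinEquiv

lemma valueShuffle_inl_lt {N d t : ℕ} (B : Fin t → Shuffle N d) (i : ℕ) {x x' : Fin N} :
    valueShuffle B i (.inl x) < valueShuffle B i (.inl x') ↔ x < x' := by
  unfold valueShuffle
  split_ifs
  · exact shuffleEquiv_inl_lt _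
  · simp [Fin.castAdd, Fin.castLE_lt_castLE_iff]

lemma valueShuffle_inr_lt {N d t : ℕ} (B : Fin t → Shuffle N d) (i : ℕ) {y y' : Fin d} :
    valueShuffle B i (.inr y) < valueShuffle B i (.inr y') ↔ y < y' := by
  unfold valueShuffle
  split_ifs
  · exact shuffleEquiv_inr_lt _
  · simp

/-- The height (shifted up by `N`) of a point: the `i`-th block of `N` points has the shape
`σ i` and the `i`-th decreasing sequence of `d` points lies in the same value block as the
`i + 1`-st block of `N` points. -/
def ladderHeight {N d t : ℕ} (B : Fin t → Shuffle N d) (σ : Fin (t + 1) → Equiv.Perm (Fin N)) :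
    Fin (t + 1) × (Fin N ⊕ Fin d) → ℕ
  | (i, .inl x) => (t + 1 - i) * (N + d) + valueShuffle B i (.inl (σ i x))
  | (i, .inr y) => (t - i) * (N + d) + valueShuffle B (i + 1) (.inr y.rev)

lemma block_lt {M a b o : ℕ} (h : a < b) (ho : o < M) (o' : ℕ) :
    a * M + o < b * M + o' := by
  have := Nat.mul_le_mul_right M (Nat.succ_le_of_lt h)
  rw [Nat.succ_mul] at this
  omega

lemma block_inj {M a b o o' : ℕ} (ho : o < M) (ho' : o' < M)
    (h : a * M + o = b * M + o') : a = b ∧ o = o' := by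
  rcases lt_trichotomy a b with hab | rfl | hab
  · exact absurd h (block_lt hab ho o').ne
  · exact ⟨rfl, by omega⟩
  · exact absurd h (block_lt hab ho' o).ne'

lemma le_ladderHeight {N d t : ℕ} (B : Fin t → Shuffle N d)
    (σ : Fin (t + 1) → Equiv.Perm (Fin N)) (x : Fin (t + 1) × (Fin N ⊕ Fin d)) :
    N ≤ ladderHeight B σ x := by
  obtain ⟨i, x | y⟩ := x
  · have h1 : 1 * (N + d) ≤ (t + 1 - i) * (N + d) := Nat.mul_le_mul_right _ (by omega)
    simp only [ladderHeight]
    omega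
  · simp only [ladderHeight]
    rcases Nat.lt_or_ge i t with hi | hi
    · have h1 : 1 * (N + d) ≤ (t - i) * (N + d) := Nat.mul_le_mul_right _ (by omega)
      omega
    · rw [valueShuffle, dif_neg (by omega)]
      simp
      omega

lemma ladderHeight_lt {N d t : ℕ} (B : Fin t → Shuffle N d)
    (σ : Fin (t + 1) → Equiv.Perm (Fin N)) (x : Fin (t + 1) × (Fin N ⊕ Fin d)) :
    ladderHeight B σ x < (t + 1) * (N + d) + N := by
  obtain ⟨i, x | y⟩ := x
  · simp only [ladderHeight]
    rcases Nat.eq_zero_or_pos (i : ℕ) with hi | hi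
    · rw [valueShuffle, dif_neg (by omega), hi]
      simp
    · exact block_lt (by omega) (Fin.isLt _) _
  · simp only [ladderHeight]
    exact block_lt (by omega) (Fin.isLt _) _

lemma ladderHeight_injective {N d t : ℕ} (B : Fin t → Shuffle N d)
    (σ : Fin (t + 1) → Equiv.Perm (Fin N)) : Function.Injective (ladderHeight B σ) := by
  rintro ⟨i, x | y⟩ ⟨i', x' | y'⟩ h <;> simp only [ladderHeight] at h <;>
    obtain ⟨h1, h2⟩ := block_inj (Fin.isLt _) (Fin.isLt _) h
  · obtain rfl : i = i' := by omega
    simpa using Fin.ext h2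
  · have : (i : ℕ) = i' + 1 := by omega
    rw [this] at h2
    simpa using Fin.ext h2
  · have : (i' : ℕ) = i + 1 := by omega
    rw [this] at h2
    simpa using Fin.ext h2
  · obtain rfl : i = i' := by omega
    simpa using Fin.ext h2

/-- The positions of the points, with the `i`-th block of `N` points and the `i`-th block of
`d` points interleaved according to `A i`. -/
def ladderPos {N d t : ℕ} (A : Fin (t + 1) → Shuffle N d) :
    Fin (t + 1) × (Fin N ⊕ Fin d) ≃ Fin ((t + 1) * (N + d)) :=
  (Equiv.prodShear (Equiv.refl _) (fun i => shuffleEquiv (A i))).trans finProdFinEquiv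

lemma ladderPos_val {N d t : ℕ} (A : Fin (t + 1) → Shuffle N d) (i : Fin (t + 1))
    (z : Fin N ⊕ Fin d) :
    (ladderPos A (i, z) : ℕ) = i * (N + d) + shuffleEquiv (A i) z := by
  simp [ladderPos, add_comm, mul_comm]

/-- The values of the points. -/
noncomputable def ladderVal {N d t : ℕ} (B : Fin t → Shuffle N d)
    (σ : Fin (t + 1) → Equiv.Perm (Fin N)) :
    Fin (t + 1) × (Fin N ⊕ Fin d) ≃ Fin ((t + 1) * (N + d)) :=
  Equiv.ofBijective (fun x => ⟨ladderHeight B σ x - N, by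
    have := ladderHeight_lt B σ x
    have := le_ladderHeight B σ x
    omega⟩) ((Fintype.bijective_iff_injective_and_card _).2 ⟨fun x y h => by
      have h1 := congrArg Fin.val h
      have := le_ladderHeight B σ x
      have := le_ladderHeight B σ y
      exact ladderHeight_injective B σ (by simp only at h1; omega), by simp⟩)

lemma ladderVal_val {N d t : ℕ} (B : Fin t → Shuffle N d)
    (σ : Fin (t + 1) → Equiv.Perm (Fin N)) (x : Fin (t + 1) × (Fin N ⊕ Fin d)) :
    (ladderVal B σ x : ℕ) + N = ladderHeight B σ x :=
  Nat.sub_add_cancel (le_ladderHeight B σ x)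

/-- The permutation with the given positions and values. -/
noncomputable def ladder {N d t : ℕ} (A : Fin (t + 1) → Shuffle N d) (B : Fin t → Shuffle N d)
    (σ : Fin (t + 1) → Equiv.Perm (Fin N)) : Equiv.Perm (Fin ((t + 1) * (N + d))) :=
  (ladderPos A).symm.trans (ladderVal B σ)

lemma ladder_ladderPos {N d t : ℕ} (A : Fin (t + 1) → Shuffle N d) (B : Fin t → Shuffle N d)
    (σ : Fin (t + 1) → Equiv.Perm (Fin N)) (x : Fin (t + 1) × (Fin N ⊕ Fin d)) :
    (ladder A B σ (ladderPos A x) : ℕ) + N = ladderHeight B σ x := by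
  simp [ladder, ladderVal_val]

/-- The points of the decreasing sequences are left-to-right minima. -/
lemma ladderHeight_inr_lt {N d t : ℕ} (A : Fin (t + 1) → Shuffle N d) (B : Fin t → Shuffle N d)
    (σ : Fin (t + 1) → Equiv.Perm (Fin N)) {x : Fin (t + 1) × (Fin N ⊕ Fin d)}
    {i : Fin (t + 1)} {y : Fin d} (h : ladderPos A x < ladderPos A (i, .inr y)) :
    ladderHeight B σ (i, .inr y) < ladderHeight B σ x := by
  obtain ⟨i', z⟩ := x
  rw [Fin.lt_def, ladderPos_val, ladderPos_val] at h
  rcases lt_trichotomy i' i with hi | rfl | hi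
  · have hi' := Fin.lt_def.1 hi
    obtain x | y' := z
    · exact block_lt (by omega) (Fin.isLt _) _
    · exact block_lt (by omega) (Fin.isLt _) _
  · obtain x | y' := z
    · exact block_lt (by omega) (Fin.isLt _) _
    · have h1 : shuffleEquiv (A i') (.inr y') < shuffleEquiv (A i') (.inr y) := by
        rw [Fin.lt_def]; omega
      rw [shuffleEquiv_inr_lt] at h1
      have h2 := (valueShuffle_inr_lt B (i' + 1)).2 (Fin.rev_lt_rev.2 h1)
      exact Nat.add_lt_add_left (Fin.lt_def.1 h2) _
  · exact absurd h (block_lt hi (Fin.isLt _) _).not_gt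

lemma ladder_avoids {k N d t : ℕ} {q : Equiv.Perm (Fin k)} {q' : Equiv.Perm (Fin (k + 1))}
    (hk : 2 ≤ k) (hq : Indecomposable q) (hq' : IsPrepend q' q)
    (A : Fin (t + 1) → Shuffle N d) (B : Fin t → Shuffle N d)
    {σ : Fin (t + 1) → Equiv.Perm (Fin N)} (hσ : ∀ i, PermAvoids (σ i) q) :
    PermAvoids (ladder A B σ) q' := by
  rintro ⟨f, hf, hfq⟩
  obtain ⟨x, hx⟩ : ∃ x, ∀ a, f a = ladderPos A (x a) :=
    ⟨fun a => (ladderPos A).symm (f a), fun a => by simp⟩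
  have hval : ∀ a b, ladderHeight B σ (x a) < ladderHeight B σ (x b) ↔ q' a < q' b := by
    intro a b
    rw [← hfq, Fin.lt_def, ← ladder_ladderPos A, ← ladder_ladderPos A, hx, hx]
    omega
  have hR : ∀ a : Fin k, ∃ i z, x a.succ = (i, Sum.inl z) := by
    intro a
    rcases hxa : x a.succ with ⟨i, z | y⟩
    · exact ⟨i, z, rfl⟩
    · exfalso
      have h1 : ladderPos A (x 0) < ladderPos A (i, .inr y) := by
        rw [← hxa, ← hx, ← hx]
        exact hf a.succ_pos
      have h2 := ladderHeight_inr_lt A B σ h1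
      rw [← hxa, hval, hq'.1] at h2
      exact absurd h2 (Fin.not_lt_zero _)
  choose i z hiz using hR
  have hpos : ∀ a b : Fin k, a < b → (i a : ℕ) * (N + d) + shuffleEquiv (A (i a)) (.inl (z a)) <
      (i b : ℕ) * (N + d) + shuffleEquiv (A (i b)) (.inl (z b)) := by
    intro a b hab
    rw [← ladderPos_val, ← ladderPos_val, ← Fin.lt_def, ← hiz, ← hiz, ← hx, ← hx]
    exact hf (Fin.succ_lt_succ_iff.2 hab)
  have hv : ∀ a b : Fin k, ladderHeight B σ (i a, .inl (z a)) <
      ladderHeight B σ (i b, .inl (z b)) ↔ q a < q b := by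
    intro a b
    rw [← hiz, ← hiz, hval, hq'.2, hq'.2, Fin.succ_lt_succ_iff]
  have hconst := hq.label_eq (b := fun a => (i a : ℕ)) (fun a b hab => by
    rcases hab.eq_or_lt with rfl | hab
    · exact le_rfl
    · by_contra! hlt
      exact absurd (hpos a b hab) (block_lt hlt (Fin.isLt _) _).not_gt) (fun a b hab => by
    rw [← hv]
    exact block_lt (by omega) (Fin.isLt _) _)
  have hi : ∀ a, i a = i ⟨0, by omega⟩ := fun a => Fin.ext (hconst _ _)
  set j := i ⟨0, by omega⟩
  refine hσ j ⟨z, fun a b hab => ?_, fun a b => ?_⟩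
  · have := hpos a b hab
    rw [hi a, hi b] at this
    rw [← shuffleEquiv_inl_lt (A j), Fin.lt_def]
    omega
  · rw [← hv, hi a, hi b, ← valueShuffle_inl_lt B j, Fin.lt_def]
    simp only [ladderHeight]
    omega

lemma shuffle_eq_of_le {N d : ℕ} {S S' : Shuffle N d} (h : S.1 ⊆ S'.1) : S = S' :=
  Subtype.ext (Finset.eq_of_subset_of_card_le h (by rw [S.2, S'.2]))

lemma ladder_injective {N d t : ℕ} {A A' : Fin (t + 1) → Shuffle N d}
    {B B' : Fin t → Shuffle N d} {σ σ' : Fin (t + 1) → Equiv.Perm (Fin N)}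
    (h : ladder A B σ = ladder A' B' σ') : A = A' ∧ B = B' ∧ σ = σ' := by
  have hA : A = A' := by
    funext i
    refine shuffle_eq_of_le fun o ho => ?_
    obtain ⟨z, rfl⟩ := (shuffleEquiv (A i)).surjective o
    obtain ⟨z', hz'⟩ := (shuffleEquiv (A' i)).surjective (shuffleEquiv (A i) z)
    have hpos : ladderPos A (i, z) = ladderPos A' (i, z') := by
      ext
      rw [ladderPos_val, ladderPos_val, hz']
    have h1 := ladder_ladderPos A B σ (i, z)
    rw [h, hpos, ladder_ladderPos] at h1
    obtain x | y := z
    · obtain x' | y' := z'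
      · rw [← hz']
        exact shuffleEquiv_inl_mem _ _
      · have := (block_inj (Fin.isLt _) (Fin.isLt _) h1).1
        omega
    · exact absurd ho (shuffleEquiv_inr_notMem _ _)
  subst hA
  have hheight : ladderHeight B σ = ladderHeight B' σ' := by
    funext x
    rw [← ladder_ladderPos A, ← ladder_ladderPos A, h]
  have hB : B = B' := by
    funext i
    refine shuffle_eq_of_le ?_
    by_contra hsub
    obtain ⟨o, ho, ho'⟩ := Finset.not_subset.1 hsub
    obtain ⟨z, rfl⟩ := (shuffleEquiv (B' i)).surjective o
    obtain x | y := z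
    · exact ho' (shuffleEquiv_inl_mem _ _)
    · have h1 := congrFun hheight (i.castSucc, .inr y.rev)
      have h2 := Fin.ext (block_inj (Fin.isLt _) (Fin.isLt _) h1).2
      simp only [Fin.val_castSucc, Fin.rev_rev] at h2
      rw [valueShuffle, valueShuffle, dif_pos (by omega), dif_pos (by omega)] at h2
      simp only [Nat.add_sub_cancel, Fin.eta] at h2
      rw [← h2] at ho
      exact shuffleEquiv_inr_notMem _ _ ho
  subst hB
  refine ⟨rfl, rfl, ?_⟩
  funext i
  ext x
  have h1 := congrFun hheight (i, .inl x)
  have h2 := Fin.ext (block_inj (Fin.isLt _) (Fin.isLt _) h1).2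
  have h3 : σ i x = σ' i x := by simpa using h2
  rw [h3]

lemma ladder_count_le {k : ℕ} {q : Equiv.Perm (Fin k)} {q' : Equiv.Perm (Fin (k + 1))}
    (hk : 2 ≤ k) (hq : Indecomposable q) (hq' : IsPrepend q' q) (N d t : ℕ) :
    (N + d).choose N ^ (t + 1) * ((N + d).choose N ^ t * avoiders N q ^ (t + 1)) ≤
      avoiders ((t + 1) * (N + d)) q' := by
  have h : Nat.card ((Fin (t + 1) → Shuffle N d) × (Fin t → Shuffle N d) ×
      (Fin (t + 1) → {p : Equiv.Perm (Fin N) // PermAvoids p q})) ≤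
      avoiders ((t + 1) * (N + d)) q' := by
    refine Nat.card_le_card_of_injective (fun x => ⟨ladder x.1 x.2.1 (fun i => (x.2.2 i).1),
      ladder_avoids hk hq hq' _ _ (fun i => (x.2.2 i).2)⟩) ?_
    rintro ⟨A, B, σ⟩ ⟨A', B', σ'⟩ hx
    obtain ⟨rfl, rfl, hσ⟩ := ladder_injective (congrArg Subtype.val hx)
    obtain rfl : σ = σ' := funext fun i => Subtype.ext (congrFun hσ i)
    rfl
  rw [Nat.card_prod, Nat.card_prod, Nat.card_fun, Nat.card_fun, Nat.card_fun,
    natCard_shuffle] at h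
  simpa [avoiders] using h

/-! ### Growth rates -/

/-- Some term of the binomial expansion of `(1 + c) ^ M` is at least the average. -/
lemma exists_le_binomial_term {c : ℝ} (M : ℕ) :
    ∃ N d : ℕ, N + d = M ∧ (1 + c) ^ M ≤ (M + 1) * ((N + d).choose N * c ^ N) := by
  by_contra! h
  have hsum : (1 + c) ^ M = ∑ m ∈ Finset.range (M + 1), c ^ m * (M.choose m : ℝ) := by
    rw [add_comm, add_pow]
    simp
  have hlt : ∑ m ∈ Finset.range (M + 1), ((M : ℝ) + 1) * (c ^ m * (M.choose m : ℝ)) <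
      ∑ m ∈ Finset.range (M + 1), (1 + c) ^ M := by
    refine Finset.sum_lt_sum_of_nonempty (by simp) fun m hm => ?_
    obtain ⟨d, hd⟩ := Nat.exists_eq_add_of_le (Nat.lt_succ_iff.1 (Finset.mem_range.1 hm))
    have := h m d hd.symm
    rw [← hd] at this
    linarith
  rw [← Finset.mul_sum, ← hsum, Finset.sum_const, Finset.card_range, nsmul_eq_mul] at hlt
  push_cast at hlt
  exact lt_irrefl _ hlt

lemma exists_sq_mul_pow_le {c e K : ℝ} (he : 0 < e) (hec : e < 1 + c) (hK : 0 < K) :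
    ∃ M : ℕ, 1 ≤ M ∧ ((M : ℝ) + 1) ^ 2 * (e ^ M) ^ 2 ≤ K * ((1 + c) ^ M) ^ 2 := by
  have hc : 0 < 1 + c := he.trans hec
  set r := (e / (1 + c)) ^ 2 with hr
  have hr0 : 0 < r := by positivity
  have hr1 : r < 1 := pow_lt_one₀ (by positivity) ((div_lt_one hc).2 hec) (by norm_num)
  have ht := tendsto_pow_const_mul_const_pow_of_abs_lt_one 2
    (by rwa [abs_of_pos hr0] : |r| < 1)
  obtain ⟨n, hn, hn2⟩ := ((ht.eventually (gt_mem_nhds (mul_pos hK hr0))).and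
    (Filter.eventually_ge_atTop 2)).exists
  obtain ⟨M, rfl⟩ : ∃ M, n = M + 1 := ⟨n - 1, by omega⟩
  refine ⟨M, by omega, ?_⟩
  rw [pow_succ r, ← mul_assoc] at hn
  have h1 := (lt_of_mul_lt_mul_right hn hr0.le).le
  have h2 : r ^ M * ((1 + c) ^ M) ^ 2 = (e ^ M) ^ 2 := by
    rw [hr, div_pow, div_pow, ← pow_mul, ← pow_mul, ← pow_mul, ← pow_mul, mul_comm M 2]
    field_simp
  push_cast at h1
  rw [← h2, ← mul_assoc]
  exact mul_le_mul_of_nonneg_right h1 (by positivity)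

/-- If `q` has at least `K * c ^ (2 * n)` avoiders, then the pattern obtained by prepending a
minimum has growth rate at least `(1 + c) ^ 2`. -/
lemma IsPrepend.exists_growth {k : ℕ} {q : Equiv.Perm (Fin k)}
    {q' : Equiv.Perm (Fin (k + 1))} (hk : 2 ≤ k) (hq : Indecomposable q) (hq' : IsPrepend q' q)
    {c e K : ℝ} (hc : 0 ≤ c) (he : 1 ≤ e) (hec : e < 1 + c) (hK : 0 < K)
    (h : ∀ n : ℕ, K * (c ^ n) ^ 2 ≤ avoiders n q) :
    ∃ K' : ℝ, 0 < K' ∧ ∀ n : ℕ, K' * (e ^ n) ^ 2 ≤ avoiders n q' := by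
  obtain ⟨M, hM, hMe⟩ := exists_sq_mul_pow_le (by linarith) hec hK
  obtain ⟨N, d, hNd, hbin⟩ := exists_le_binomial_term (c := c) M
  have hcount := ladder_count_le hk hq hq' N d
  have hCpos : 1 ≤ (N + d).choose N := Nat.choose_pos (by omega)
  have hspos := one_le_avoiders hk hq N
  have hN := h N
  rw [hNd] at hcount hbin hCpos
  set C := M.choose N
  set s := avoiders N q
  have hX : (e ^ M) ^ 2 ≤ (C : ℝ) ^ 2 * s := by
    have h1 : ((1 + c) ^ M) ^ 2 ≤ ((M + 1) * (C * c ^ N)) ^ 2 :=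
      pow_le_pow_left₀ (by positivity) hbin 2
    have h2 : ((M : ℝ) + 1) ^ 2 * (e ^ M) ^ 2 ≤ ((M : ℝ) + 1) ^ 2 * ((C : ℝ) ^ 2 * s) :=
      calc ((M : ℝ) + 1) ^ 2 * (e ^ M) ^ 2 ≤ K * ((1 + c) ^ M) ^ 2 := hMe
        _ ≤ K * ((M + 1) * (C * c ^ N)) ^ 2 := mul_le_mul_of_nonneg_left h1 hK.le
        _ = ((M : ℝ) + 1) ^ 2 * ((C : ℝ) ^ 2 * (K * (c ^ N) ^ 2)) := by ring
        _ ≤ ((M : ℝ) + 1) ^ 2 * ((C : ℝ) ^ 2 * s) := by gcongr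
    exact le_of_mul_le_mul_left h2 (by positivity)
  have hblocks : ∀ t : ℕ, (e ^ (M * t)) ^ 2 ≤ avoiders ((t + 1) * M) q' := by
    intro t
    have h1 : (C ^ 2 * s) ^ t ≤ avoiders ((t + 1) * M) q' := by
      refine le_trans ?_ (hcount t)
      have : C ^ (t + 1) * (C ^ t * s ^ (t + 1)) = (C ^ 2 * s) ^ t * (C * s) := by ring
      rw [this]
      exact Nat.le_mul_of_pos_right _ (Nat.mul_pos hCpos hspos)
    calc (e ^ (M * t)) ^ 2 = ((e ^ M) ^ 2) ^ t := by
          ring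
      _ ≤ ((C : ℝ) ^ 2 * s) ^ t := pow_le_pow_left₀ (by positivity) hX t
      _ ≤ avoiders ((t + 1) * M) q' := by exact_mod_cast h1
  refine ⟨((e ^ (2 * M)) ^ 2)⁻¹, by positivity, fun n => ?_⟩
  rw [inv_mul_le_iff₀ (by positivity)]
  have hk' : 2 ≤ k + 1 := by omega
  rcases Nat.lt_or_ge n M with hn | hn
  · have h1 : (1 : ℝ) ≤ avoiders n q' := by
      exact_mod_cast one_le_avoiders hk' hq'.indecomposable n
    calc (e ^ n) ^ 2 ≤ (e ^ (2 * M)) ^ 2 := by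
          gcongr
          omega
      _ = (e ^ (2 * M)) ^ 2 * 1 := (mul_one _).symm
      _ ≤ _ := by gcongr
  · obtain ⟨t, ht⟩ : ∃ t, n / M = t + 1 :=
      ⟨n / M - 1, by have := Nat.div_pos hn hM; omega⟩
    have h1 : (t + 1) * M ≤ n := ht ▸ Nat.div_mul_le_self n M
    have h2 : n ≤ 2 * M + M * t := by
      have := Nat.div_add_mod n M
      have := Nat.mod_lt n hM
      rw [ht] at *
      nlinarith
    calc (e ^ n) ^ 2 ≤ (e ^ (2 * M + M * t)) ^ 2 := by
          gcongr
      _ = (e ^ (2 * M)) ^ 2 * (e ^ (M * t)) ^ 2 := by rw [pow_add, mul_pow]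
      _ ≤ (e ^ (2 * M)) ^ 2 * avoiders ((t + 1) * M) q' := by gcongr; exact hblocks t
      _ ≤ _ := by
        gcongr
        exact avoiders_mono hk' hq'.indecomposable h1

/-- A lower bound on the growth rate gives a uniform lower bound. -/
lemma exists_growth_of_tendsto {k : ℕ} {q : Equiv.Perm (Fin k)} (hk : 2 ≤ k)
    (hq : Indecomposable q) {L c : ℝ}
    (hL : Filter.Tendsto (fun n : ℕ => (avoiders n q : ℝ) ^ (1 / (n : ℝ)))
      Filter.atTop (nhds L)) (hc : 0 ≤ c) (hcL : c ^ 2 < L) :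
    ∃ K : ℝ, 0 < K ∧ ∀ n : ℕ, K * (c ^ n) ^ 2 ≤ avoiders n q := by
  obtain ⟨n₀, hn₀⟩ := Filter.eventually_atTop.1
    ((hL.eventually (lt_mem_nhds hcL)).and (Filter.eventually_ge_atTop 1))
  refine ⟨(((1 + c) ^ n₀) ^ 2)⁻¹, by positivity, fun n => ?_⟩
  rw [inv_mul_le_iff₀ (by positivity)]
  rcases Nat.lt_or_ge n n₀ with hn | hn
  · have h1 : (1 : ℝ) ≤ avoiders n q := by exact_mod_cast one_le_avoiders hk hq n
    calc (c ^ n) ^ 2 ≤ ((1 + c) ^ n) ^ 2 := by gcongr; linarith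
      _ ≤ ((1 + c) ^ n₀) ^ 2 := by gcongr; linarith
      _ = ((1 + c) ^ n₀) ^ 2 * 1 := (mul_one _).symm
      _ ≤ _ := by gcongr
  · obtain ⟨h1, h2⟩ := hn₀ n hn
    have h3 : (c ^ n) ^ 2 ≤ avoiders n q := by
      have h4 := pow_le_pow_left₀ (by positivity) h1.le n
      rw [one_div, Real.rpow_inv_natCast_pow (Nat.cast_nonneg _) (by omega)] at h4
      rwa [← pow_mul, mul_comm, pow_mul]
    have h5 : (1 : ℝ) ≤ ((1 + c) ^ n₀) ^ 2 :=
      one_le_pow₀ (one_le_pow₀ (by linarith))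
    exact h3.trans (le_mul_of_one_le_left (Nat.cast_nonneg _) h5)

/-- The growth sequence of a permutation class does not tend to infinity. -/
lemma isCoboundedUnder_avoiders {k : ℕ} (q : Equiv.Perm (Fin k)) :
    Filter.IsCoboundedUnder (· ≥ ·) Filter.atTop
      (fun n : ℕ => (avoiders n q : ℝ) ^ (1 / (n : ℝ))) := by
  obtain ⟨B, hB⟩ := exists_avoiders_two_pow_le q
  refine ⟨B, fun a ha => ?_⟩
  have ha' : ∀ᶠ n : ℕ in Filter.atTop, a ≤ (avoiders n q : ℝ) ^ (1 / (n : ℝ)) := ha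
  obtain ⟨m, hm⟩ := ((tendsto_pow_atTop_atTop_of_one_lt (r := 2)
    (by norm_num)).eventually ha').exists
  refine hm.trans ?_
  have h1 : (avoiders (2 ^ m) q : ℝ) ≤ (B : ℝ) ^ 2 ^ m := by exact_mod_cast hB m
  refine (Real.rpow_le_rpow (Nat.cast_nonneg _) h1 (by positivity)).trans_eq ?_
  rw [one_div, Real.pow_rpow_inv_natCast (Nat.cast_nonneg _) (by positivity)]

lemma sq_le_liminf_of_growth {k : ℕ} {q : Equiv.Perm (Fin k)} {e e' K : ℝ} (he : 0 < e)
    (hee : e < e') (hK : 0 < K) (h : ∀ n : ℕ, K * (e' ^ n) ^ 2 ≤ avoiders n q) :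
    e ^ 2 ≤ Filter.liminf (fun n : ℕ => (avoiders n q : ℝ) ^ (1 / (n : ℝ))) Filter.atTop := by
  refine Filter.le_liminf_of_le (isCoboundedUnder_avoiders q) ?_
  have he' : 0 < e' := he.trans hee
  have ht := tendsto_pow_atTop_nhds_zero_of_lt_one (r := (e / e') ^ 2) (by positivity)
    (pow_lt_one₀ (by positivity) ((div_lt_one he').2 hee) (by norm_num))
  filter_upwards [ht.eventually (gt_mem_nhds hK), Filter.eventually_ge_atTop 1] with n hn hn1
  have h1 : (e ^ 2) ^ n ≤ avoiders n q := by
    refine le_trans ?_ (h n)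
    have h2 := mul_le_mul_of_nonneg_right hn.le (by positivity : 0 ≤ (e' ^ n) ^ 2)
    refine le_trans (le_of_eq ?_) h2
    rw [div_pow, div_pow, ← pow_mul, ← pow_mul, ← pow_mul, mul_comm n 2]
    field_simp
  have h3 := Real.rpow_le_rpow (by positivity) h1 (by positivity : 0 ≤ (n : ℝ)⁻¹)
  rwa [Real.pow_rpow_inv_natCast (by positivity) (by omega), ← one_div] at h3

lemma isPrepend_revCompl {k : ℕ} {q : Equiv.Perm (Fin k)} {q₁ : Equiv.Perm (Fin (k + 1))}
    {q'' : Equiv.Perm (Fin (k + 2))} (hq₁ : IsPrepend q₁ q) (hq''0 : q'' 0 = 0)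
    (hq''mid : ∀ i : Fin k, q'' i.succ.castSucc = (q i).succ.castSucc)
    (hq''last : q'' (Fin.last (k + 1)) = Fin.last (k + 1)) :
    IsPrepend (revCompl q'') (revCompl q₁) := by
  refine ⟨by simp [hq''last], fun i => ?_⟩
  simp only [revCompl_apply, Fin.rev_succ]
  generalize i.rev = j
  induction j using Fin.cases with
  | zero => rw [Fin.castSucc_zero, hq''0, hq₁.1, Fin.rev_zero, Fin.rev_zero, Fin.succ_last]
  | succ l => rw [hq''mid, hq₁.2, Fin.rev_castSucc]

/-- If `q` is an indecomposable pattern of length `k ≥ 2`, `q''` is obtained from `q` by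
adding 1 to each entry, prepending the entry 1 and appending the entry `k+2`, and
`(S_n(q))^{1/n} → L`, then `liminf (S_n(q''))^{1/n} ≥ (2 + √L)²`. -/
theorem stanley_wilf_liminf_sandwich_indecomposable {k : ℕ} (hk : 2 ≤ k)
    (q : Equiv.Perm (Fin k)) (hq : Indecomposable q)
    (q'' : Equiv.Perm (Fin (k + 2)))
    (hq''0 : q'' 0 = 0)
    (hq''mid : ∀ i : Fin k, q'' i.succ.castSucc = (q i).succ.castSucc)
    (hq''last : q'' (Fin.last (k + 1)) = Fin.last (k + 1))
    (L : ℝ)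
    (hL : Filter.Tendsto (fun n : ℕ => (avoiders n q : ℝ) ^ (1 / (n : ℝ)))
      Filter.atTop (nhds L)) :
    (2 + Real.sqrt L) ^ 2 ≤
      Filter.liminf (fun n : ℕ => (avoiders n q'' : ℝ) ^ (1 / (n : ℝ))) Filter.atTop := by
  have hL1 : 1 ≤ L := ge_of_tendsto' hL fun n => by
    refine Real.one_le_rpow ?_ (by positivity)
    exact_mod_cast one_le_avoiders hk hq n
  have hs : 0 < Real.sqrt L := Real.sqrt_pos.2 (by linarith)
  obtain ⟨q₁, hq₁⟩ := exists_isPrepend q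
  have hrev := isPrepend_revCompl hq₁ hq''0 hq''mid hq''last
  have key : ∀ e, 1 ≤ e → e < 2 + Real.sqrt L → e ^ 2 ≤
      Filter.liminf (fun n : ℕ => (avoiders n q'' : ℝ) ^ (1 / (n : ℝ))) Filter.atTop := by
    intro e he heL
    obtain ⟨e₂, hee₂, he₂⟩ := exists_between heL
    obtain ⟨e₁, he₁, he₁L⟩ := exists_between
      (show max 1 (e₂ - 1) < 1 + Real.sqrt L from max_lt (by linarith) (by linarith))
    obtain ⟨c, hc, hcL⟩ := exists_between
      (show max 0 (e₁ - 1) < Real.sqrt L from max_lt hs (by linarith))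
    obtain ⟨he₁1, he₁2⟩ := max_lt_iff.1 he₁
    obtain ⟨hc0, hc1⟩ := max_lt_iff.1 hc
    obtain ⟨K, hK, hKn⟩ := exists_growth_of_tendsto hk hq hL hc0.le
      ((Real.lt_sqrt hc0.le).1 hcL)
    obtain ⟨K₁, hK₁, hKn₁⟩ := hq₁.exists_growth hk hq hc0.le he₁1.le (by linarith) hK hKn
    obtain ⟨K₂, hK₂, hKn₂⟩ := hrev.exists_growth (by omega) hq₁.indecomposable.revCompl
      (by linarith : 0 ≤ e₁) (by linarith : 1 ≤ e₂) (by linarith) hK₁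
      (fun n => (hKn₁ n).trans (by exact_mod_cast avoiders_revCompl_le n q₁))
    refine sq_le_liminf_of_growth (by linarith) hee₂ hK₂ fun n => (hKn₂ n).trans ?_
    have := avoiders_revCompl_le n (revCompl q'')
    rw [revCompl_revCompl] at this
    exact_mod_cast this
  by_contra! hlt
  set X := Filter.liminf (fun n : ℕ => (avoiders n q'' : ℝ) ^ (1 / (n : ℝ))) Filter.atTop
  have hX : Real.sqrt X < 2 + Real.sqrt L := (Real.sqrt_lt' (by linarith)).2 hlt
  obtain ⟨e, he, heL⟩ := exists_between
    (show max 1 (Real.sqrt X) < 2 + Real.sqrt L from max_lt (by linarith) hX)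
  obtain ⟨he1, heX⟩ := max_lt_iff.1 he
  exact absurd (key e he1.le heL) (not_le.2 ((Real.sqrt_lt' (by linarith)).1 heX))
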